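/- (Hladnik.) Let φ : ℕ × ℕ → ℂ be a Schur multiplier. Then the bounded linear map S_φ : B(ℓ²) → B(ℓ²) is a compact operator if and only if there exist sequences of functions a_k, b_k : ℕ → ℂ (k ∈ ℕ), each vanishing at infinity (a_k, b_k ∈ c₀), such that φ(i,j) = Σ_{k=1}^∞ a_k(i) b_k(j) for all i, j, with sup_i Σ_{k=1}^∞ |a_k(i)|² < ∞ and sup_j Σ_{k=1}^∞ |b_k(j)|² < ∞, and such that the series of functions Σ_{k=1}^∞ |a_k(·)|² and Σ_{k=1}^∞ |b_k(·)|² converge uniformly on ℕ. -/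

import Mathlib

open scoped InnerProductSpace

noncomputable section

/-- The Hilbert space `ℓ² = ℓ²(ℕ, ℂ)`. -/
abbrev l2 : Type := lp (fun _ : ℕ => ℂ) 2

/-- The standard orthonormal basis vector `e i` of `ℓ²`. -/
def e (i : ℕ) : l2 := lp.single 2 i 1

/-- The matrix entry `a(i,j) = ⟪A e_j, e_i⟫` of a bounded operator `A` on `ℓ²`. -/
def ent (A : l2 →L[ℂ] l2) (i j : ℕ) : ℂ := ⟪A (e j), e i⟫_ℂ

/-- A function `φ : ℕ × ℕ → ℂ` is a Schur multiplier if for every bounded operator `A` on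
`ℓ²` there is a bounded operator on `ℓ²` whose matrix is `(φ(i,j) * a(i,j))`. -/
def IsSchurMultiplier (φ : ℕ × ℕ → ℂ) : Prop :=
  ∀ A : l2 →L[ℂ] l2, ∃ B : l2 →L[ℂ] l2, ∀ i j, ent B i j = φ (i, j) * ent A i j

lemma hb_finite {ι : Type} [Fintype ι] [DecidableEq ι] (φ : ι → ι → ℂ)
    (H : ∀ a : ι → ι → ℂ,
      (∀ σ τ : ι → ℂ, ‖∑ i, ∑ j, a i j * σ i * τ j‖ ≤ ∑ i, ‖σ i‖ ^ 2 + ∑ j, ‖τ j‖ ^ 2) →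
      ∀ σ τ : ι → ℂ, ‖∑ i, ∑ j, φ i j * a i j * σ i * τ j‖ ≤
        ∑ i, ‖σ i‖ ^ 2 + ∑ j, ‖τ j‖ ^ 2) :
    ∃ (m : ℕ) (s t : ℕ → ι → ℂ), (∀ i, ∑ k ∈ Finset.range m, ‖s k i‖ ^ 2 ≤ 3) ∧
      (∀ j, ∑ k ∈ Finset.range m, ‖t k j‖ ^ 2 ≤ 3) ∧
      ∀ i j, φ i j = ∑ k ∈ Finset.range m, s k i * t k j := by
  classical
  let E := (ι → ℝ) × (ι → ℝ) × (ι → ι → ℂ)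
  let C : Set E := {z | ∃ (m : ℕ) (s t : ℕ → ι → ℂ),
      (∀ i, ∑ k ∈ Finset.range m, ‖s k i‖ ^ 2 ≤ z.1 i) ∧
      (∀ j, ∑ k ∈ Finset.range m, ‖t k j‖ ^ 2 ≤ z.2.1 j) ∧
      ∀ i j, z.2.2 i j = ∑ k ∈ Finset.range m, s k i * t k j}
  have hadd : ∀ z ∈ C, ∀ w ∈ C, z + w ∈ C := by
    rintro z ⟨m, s, t, h1, h2, h3⟩ w ⟨m', s', t', h1', h2', h3'⟩
    refine ⟨m + m', fun k => if k < m then s k else s' (k - m),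
      fun k => if k < m then t k else t' (k - m), ?_, ?_, ?_⟩
    · intro i
      rw [Finset.sum_range_add]
      refine add_le_add (le_trans (le_of_eq ?_) (h1 i)) (le_trans (le_of_eq ?_) (h1' i))
      · exact Finset.sum_congr rfl fun k hk => by simp [Finset.mem_range.1 hk]
      · exact Finset.sum_congr rfl fun k hk => by simp
    · intro i
      rw [Finset.sum_range_add]
      refine add_le_add (le_trans (le_of_eq ?_) (h2 i)) (le_trans (le_of_eq ?_) (h2' i))
      · exact Finset.sum_congr rfl fun k hk => by simp [Finset.mem_range.1 hk]
      · exact Finset.sum_congr rfl fun k hk => by simp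
    · intro i j
      rw [Finset.sum_range_add]
      change z.2.2 i j + w.2.2 i j = _
      rw [h3, h3']
      congr 1
      · exact Finset.sum_congr rfl fun k hk => by simp [Finset.mem_range.1 hk]
      · exact Finset.sum_congr rfl fun k hk => by simp
  have hsmul : ∀ z ∈ C, ∀ r : ℝ, 0 ≤ r → r • z ∈ C := by
    rintro z ⟨m, s, t, h1, h2, h3⟩ r hr
    refine ⟨m, fun k i => (Real.sqrt r : ℂ) * s k i, fun k i => (Real.sqrt r : ℂ) * t k i,
      ?_, ?_, ?_⟩
    · intro i
      simp only [norm_mul, mul_pow, ← Finset.mul_sum]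
      simp only [Complex.norm_real, Real.norm_eq_abs, sq_abs, Real.sq_sqrt hr]
      exact mul_le_mul_of_nonneg_left (h1 i) hr
    · intro i
      simp only [norm_mul, mul_pow, ← Finset.mul_sum]
      simp only [Complex.norm_real, Real.norm_eq_abs, sq_abs, Real.sq_sqrt hr]
      exact mul_le_mul_of_nonneg_left (h2 i) hr
    · intro i j
      change r • z.2.2 i j = _
      rw [h3, Finset.smul_sum]
      refine Finset.sum_congr rfl fun k _ => ?_
      have : (r : ℂ) = (Real.sqrt r : ℂ) * (Real.sqrt r : ℂ) := by
        rw [← Complex.ofReal_mul, Real.mul_self_sqrt hr]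
      rw [Complex.real_smul, this]; ring
  have hconv : Convex ℝ C := by
    intro z hz w hw a b ha hb _
    exact hadd _ (hsmul z hz a ha) _ (hsmul w hw b hb)
  -- perturbation
  have hpert : (((fun _ => 1), (fun _ => 1), φ) : E) ∈ closure C →
      (((fun _ => 3), (fun _ => 3), φ) : E) ∈ C := by
    intro hcl
    set n : ℝ := (Fintype.card ι : ℝ) with hn
    have hn0 : 0 ≤ n := by positivity
    obtain ⟨z, hz, hd⟩ := Metric.mem_closure_iff.1 hcl (1 / (n + 1)) (by positivity)
    have hδ : 1 / (n + 1) ≤ 1 := by rw [div_le_one (by positivity)]; linarith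
    rw [Prod.dist_eq, Prod.dist_eq, max_lt_iff, max_lt_iff] at hd
    obtain ⟨d1, d2, d3⟩ := hd
    have key : (((fun _ => 3), (fun _ => 3), φ) : E) - z ∈ C := by
      refine ⟨Fintype.card ι, fun k i => if ((Fintype.equivFin ι i : Fin _) : ℕ) = k then 1 else 0,
        fun k j => if h : k < Fintype.card ι then
          φ ((Fintype.equivFin ι).symm ⟨k, h⟩) j - z.2.2 ((Fintype.equivFin ι).symm ⟨k, h⟩) j
          else 0, ?_, ?_, ?_⟩
      · intro i
        have h := (dist_le_pi_dist _ _ i).trans d1.le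
        rw [Real.dist_eq] at h
        have h := (abs_le.1 h)
        simp only [apply_ite norm, norm_one, norm_zero, ite_pow, one_pow, zero_pow two_ne_zero]
        rw [Finset.sum_ite_eq]
        simp only [Finset.mem_range, Fin.is_lt, if_true]
        change 1 ≤ (3:ℝ) - z.1 i
        simp only at h
        linarith [h.1]
      · intro j
        have h := (dist_le_pi_dist _ _ j).trans d2.le
        rw [Real.dist_eq] at h
        have h := (abs_le.1 h)
        change _ ≤ (3:ℝ) - z.2.1 j
        simp only at h
        have : ∑ k ∈ Finset.range (Fintype.card ι), ‖(if h : k < Fintype.card ι then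
          φ ((Fintype.equivFin ι).symm ⟨k, h⟩) j - z.2.2 ((Fintype.equivFin ι).symm ⟨k, h⟩) j
          else 0 : ℂ)‖ ^ 2 ≤ ∑ k ∈ Finset.range (Fintype.card ι), (1 / (n + 1)) := by
          refine Finset.sum_le_sum fun k hk => ?_
          rw [dif_pos (Finset.mem_range.1 hk), ← dist_eq_norm]
          have h4 := ((dist_le_pi_dist (φ ((Fintype.equivFin ι).symm ⟨k, Finset.mem_range.1 hk⟩))
            (z.2.2 ((Fintype.equivFin ι).symm ⟨k, Finset.mem_range.1 hk⟩)) j).trans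
            (dist_le_pi_dist φ z.2.2
            ((Fintype.equivFin ι).symm ⟨k, Finset.mem_range.1 hk⟩))).trans d3.le
          refine le_trans (pow_le_of_le_one dist_nonneg (h4.trans hδ) two_ne_zero) h4
        refine this.trans ?_
        rw [Finset.sum_const, Finset.card_range, nsmul_eq_mul, ← hn]
        have : n * (1 / (n + 1)) ≤ 1 := by
          rw [mul_one_div, div_le_one (by positivity)]; linarith
        linarith [h.1]
      · intro i j
        change φ i j - z.2.2 i j = _
        simp only [ite_mul, one_mul, zero_mul]
        rw [Finset.sum_ite_eq]
        simp
    have := hadd _ key _ hz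
    rwa [sub_add_cancel] at this
  suffices h : (((fun _ => 1), (fun _ => 1), φ) : E) ∈ closure C by
    obtain ⟨m, s, t, h1, h2, h3⟩ := hpert h
    exact ⟨m, s, t, h1, h2, h3⟩
  by_contra hnot
  obtain ⟨f, u, hfu, hf⟩ := geometric_hahn_banach_point_closed hconv.closure isClosed_closure hnot
  have h0C : (0 : E) ∈ C := ⟨0, fun _ _ => 0, fun _ _ => 0, by simp, by simp, by simp⟩
  have hu : u < 0 := by simpa using hf 0 (subset_closure h0C)
  have hpos : ∀ z ∈ C, 0 ≤ f z := by
    intro z hz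
    by_contra hneg
    push Not at hneg
    have := hf _ (subset_closure (hsmul z hz (u / f z) (div_nonneg_of_nonpos hu.le hneg.le)))
    rw [map_smul, smul_eq_mul, div_mul_cancel₀ _ hneg.ne] at this
    exact lt_irrefl _ this
  let lam : ι → ℝ := fun i => f (Pi.single i 1, 0, 0)
  let mu : ι → ℝ := fun i => f (0, Pi.single i 1, 0)
  let M : ι → ι → ℂ := fun i j => (f (0, 0, Pi.single i (Pi.single j 1)) : ℂ)
    - Complex.I * (f (0, 0, Pi.single i (Pi.single j Complex.I)) : ℂ)
  have hfeq : ∀ (d d' : ι → ℝ) (ψ : ι → ι → ℂ), f (d, d', ψ) =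
      ∑ i, d i * lam i + ∑ i, d' i * mu i + (∑ i, ∑ j, M i j * ψ i j).re := by
    intro d d' ψ
    have e1 : ((d, d', ψ) : E) = ∑ i, d i • ((Pi.single i 1, 0, 0) : E) +
        ∑ i, d' i • ((0, Pi.single i 1, 0) : E) +
        ∑ i, ∑ j, ((ψ i j).re • ((0, 0, Pi.single i (Pi.single j 1)) : E) +
          (ψ i j).im • ((0, 0, Pi.single i (Pi.single j Complex.I)) : E)) := by
      refine Prod.ext ?_ (Prod.ext ?_ ?_)
      · ext x
        simp [Prod.fst_sum, Finset.sum_apply, Pi.single_apply]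
      · ext x
        simp [Prod.fst_sum, Prod.snd_sum, Finset.sum_apply, Pi.single_apply]
      · ext x y
        simp only [Prod.snd_add, Prod.snd_sum, Prod.smul_snd, smul_zero, Finset.sum_const_zero,
          zero_add, Finset.sum_apply, Pi.add_apply, Pi.smul_apply]
        rw [Finset.sum_eq_single x, Finset.sum_eq_single y]
        · simp
        · intro b _ hb
          simp [hb.symm]
        · simp
        · intro b _ hb
          simp [hb.symm]
        · simp
    rw [e1]
    simp only [map_add, map_sum, map_smul, smul_eq_mul, Complex.re_sum]
    congr 1
    refine Finset.sum_congr rfl fun i _ => Finset.sum_congr rfl fun j _ => ?_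
    simp [M]
    ring
  -- bound
  have hrank : ∀ s t : ι → ℂ, 0 ≤ ∑ i, ‖s i‖ ^ 2 * lam i + ∑ i, ‖t i‖ ^ 2 * mu i
      + (∑ i, ∑ j, M i j * (s i * t j)).re := by
    intro s t
    rw [← hfeq (fun i => ‖s i‖ ^ 2) (fun i => ‖t i‖ ^ 2) (fun i j => s i * t j)]
    exact hpos _ ⟨1, fun _ => s, fun _ => t, by simp, by simp, by simp⟩
  have hbd : ∀ s t : ι → ℂ, ‖∑ i, ∑ j, M i j * (s i * t j)‖ ≤
      ∑ i, ‖s i‖ ^ 2 * lam i + ∑ i, ‖t i‖ ^ 2 * mu i := by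
    intro s t
    set X := ∑ i, ∑ j, M i j * (s i * t j) with hX
    by_cases hX0 : X = 0
    · have := hrank s t
      rw [← hX, hX0] at this
      simpa [hX0] using this
    · have hXn : (‖X‖ : ℂ) ≠ 0 := by simpa using hX0
      set w : ℂ := -(starRingEnd ℂ X) / ‖X‖ with hw
      have hwn : ‖w‖ = 1 := by
        rw [hw, norm_div, norm_neg, RCLike.norm_conj, Complex.norm_real, norm_norm,
          div_self (by simpa using hX0)]
      have h := hrank (fun i => w * s i) t
      have e2 : ∑ i, ∑ j, M i j * (w * s i * t j) = w * X := by
        rw [hX, Finset.mul_sum]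
        refine Finset.sum_congr rfl fun i _ => ?_
        rw [Finset.mul_sum]
        exact Finset.sum_congr rfl fun j _ => by ring
      have e3 : w * X = -(‖X‖ : ℂ) := by
        rw [hw, div_mul_eq_mul_div, neg_mul, mul_comm, Complex.mul_conj, Complex.normSq_eq_norm_sq]
        field_simp
        push_cast; ring
      rw [e2, e3] at h
      simp only [norm_mul, hwn, one_mul, Complex.neg_re, Complex.ofReal_re] at h
      linarith
  have hlam : ∀ i, 0 ≤ lam i := fun i =>
    hpos _ ⟨1, fun _ => Pi.single i 1, fun _ => 0, by
      intro x
      by_cases hx : x = i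
      · subst hx; simp
      · simp [hx], by simp, by simp⟩
  have hmu : ∀ i, 0 ≤ mu i := fun i =>
    hpos _ ⟨1, fun _ => 0, fun _ => Pi.single i 1, by simp, by
      intro x
      by_cases hx : x = i
      · subst hx; simp
      · simp [hx], by simp⟩
  have hneg : ∑ i, lam i + ∑ i, mu i + (∑ i, ∑ j, M i j * φ i j).re < 0 := by
    have := hfeq (fun _ => 1) (fun _ => 1) φ
    simp only [one_mul] at this
    rw [← this]; linarith
  set X := ∑ i, ∑ j, M i j * φ i j with hX
  -- regularize
  obtain ⟨ε, hε, hεX⟩ : ∃ ε : ℝ, 0 < ε ∧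
      ∑ i, (lam i + ε) + ∑ i, (mu i + ε) + X.re < 0 := by
    refine ⟨-(∑ i, lam i + ∑ i, mu i + X.re) / (2 * (Fintype.card ι + 1)), ?_, ?_⟩
    · apply div_pos <;> [linarith; positivity]
    · simp only [Finset.sum_add_distrib, Finset.sum_const, Finset.card_univ, nsmul_eq_mul]
      set Y := ∑ i, lam i + ∑ i, mu i + X.re with hY
      have : (Fintype.card ι : ℝ) * (-Y / (2 * (Fintype.card ι + 1))) < -Y / 2 := by
        rw [mul_div_assoc', div_lt_div_iff₀ (by positivity) (by positivity)]
        nlinarith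
      linarith
  have hp : ∀ i, 0 < lam i + ε := fun i => by linarith [hlam i]
  have hq : ∀ i, 0 < mu i + ε := fun i => by linarith [hmu i]
  let p : ι → ℝ := fun i => Real.sqrt (lam i + ε)
  let q : ι → ℝ := fun i => Real.sqrt (mu i + ε)
  have hp0 : ∀ i, 0 < p i := fun i => Real.sqrt_pos.2 (hp i)
  have hq0 : ∀ i, 0 < q i := fun i => Real.sqrt_pos.2 (hq i)
  have hpC : ∀ i, (p i : ℂ) ≠ 0 := fun i => by exact_mod_cast (hp0 i).ne'
  have hqC : ∀ i, (q i : ℂ) ≠ 0 := fun i => by exact_mod_cast (hq0 i).ne'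
  have hpsq : ∀ i, p i ^ 2 = lam i + ε := fun i => Real.sq_sqrt (hp i).le
  have hqsq : ∀ i, q i ^ 2 = mu i + ε := fun i => Real.sq_sqrt (hq i).le
  have hfin := H (fun i j => M i j / (p i * q j)) (by
    intro σ τ
    have h := hbd (fun i => σ i / p i) (fun j => τ j / q j)
    refine le_trans (le_of_eq ?_) (h.trans (add_le_add ?_ ?_))
    · congr 1
      refine Finset.sum_congr rfl fun i _ => Finset.sum_congr rfl fun j _ => ?_
      have := hpC i
      have := hqC j
      field_simp
    · refine Finset.sum_le_sum fun i _ => ?_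
      rw [norm_div, div_pow, Complex.norm_real, Real.norm_eq_abs, sq_abs, hpsq,
        div_mul_eq_mul_div, div_le_iff₀ (hp i)]
      exact mul_le_mul_of_nonneg_left (by linarith) (by positivity)
    · refine Finset.sum_le_sum fun i _ => ?_
      rw [norm_div, div_pow, Complex.norm_real, Real.norm_eq_abs, sq_abs, hqsq,
        div_mul_eq_mul_div, div_le_iff₀ (hq i)]
      exact mul_le_mul_of_nonneg_left (by linarith) (by positivity)) (fun i => p i) (fun j => q j)
  have e4 : ∑ i, ∑ j, φ i j * (M i j / (p i * q j)) * p i * q j = X := by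
    refine Finset.sum_congr rfl fun i _ => Finset.sum_congr rfl fun j _ => ?_
    have := hpC i
    have := hqC j
    field_simp
  rw [e4] at hfin
  simp only [Complex.norm_real, Real.norm_eq_abs, sq_abs, hpsq, hqsq] at hfin
  have := Complex.abs_re_le_norm X
  have := neg_abs_le X.re
  linarith

def BB (c : ℝ) (a : ℕ → ℕ → ℂ) : Prop :=
  ∀ (N : ℕ) (σ τ : ℕ → ℂ),
    ‖∑ i ∈ Finset.range N, ∑ j ∈ Finset.range N, a i j * σ i * τ j‖ ≤
      c * (∑ i ∈ Finset.range N, ‖σ i‖ ^ 2 + ∑ j ∈ Finset.range N, ‖τ j‖ ^ 2)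

def V (N : ℕ) (σ : ℕ → ℂ) : l2 := ∑ i ∈ Finset.range N, σ i • e i

lemma inner_e_left (i : ℕ) (x : l2) : ⟪e i, x⟫_ℂ = x i := by
  rw [e, lp.inner_single_left]; simp

lemma e_apply (i j : ℕ) : (e i) j = if j = i then 1 else 0 := by
  rw [e, lp.single_apply, Pi.single_apply]

lemma inner_e_e (i j : ℕ) : ⟪e i, e j⟫_ℂ = if i = j then 1 else 0 := by
  rw [inner_e_left, e_apply]

lemma e_orthonormal : Orthonormal ℂ e := by
  rw [orthonormal_iff_ite]; exact inner_e_e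

lemma V_eq (N : ℕ) (σ : ℕ → ℂ) : V N σ = ∑ i ∈ Finset.range N, lp.single 2 i (σ i) := by
  refine Finset.sum_congr rfl fun i _ => ?_
  rw [e, ← lp.single_smul]; simp

lemma V_norm (N : ℕ) (σ : ℕ → ℂ) : ‖V N σ‖ ^ 2 = ∑ i ∈ Finset.range N, ‖σ i‖ ^ 2 := by
  have h := lp.norm_sum_single (p := 2) (E := fun _ : ℕ => ℂ) (by norm_num) σ (Finset.range N)
  rw [← V_eq] at h
  simpa using h

lemma V_norm_le (N : ℕ) (x : l2) : ∑ i ∈ Finset.range N, ‖x i‖ ^ 2 ≤ ‖x‖ ^ 2 := by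
  have := lp.sum_rpow_le_norm_rpow (p := 2) (by norm_num) x (Finset.range N)
  simpa using this

lemma V_tendsto (x : l2) : Filter.Tendsto (fun N => V N x) Filter.atTop (nhds x) := by
  have h := (lp.hasSum_single (p := 2) (by norm_num) x).tendsto_sum_nat
  simpa only [V_eq] using h

lemma inner_V (A : l2 →L[ℂ] l2) (N : ℕ) (σ τ : ℕ → ℂ) :
    ⟪A (V N τ), V N σ⟫_ℂ = ∑ i ∈ Finset.range N, ∑ j ∈ Finset.range N,
      ent A i j * σ i * (starRingEnd ℂ) (τ j) := by
  simp only [V, map_sum, map_smul, sum_inner, inner_sum, inner_smul_left, inner_smul_right, ent]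
  refine Finset.sum_congr rfl fun i _ => ?_
  rw [Finset.mul_sum]
  refine Finset.sum_congr rfl fun j _ => ?_
  ring

lemma BB_of_op (A : l2 →L[ℂ] l2) : BB (‖A‖ / 2) (ent A) := by
  intro N σ τ
  have h := inner_V A N σ (fun j => (starRingEnd ℂ) (τ j))
  simp only [Complex.conj_conj] at h
  rw [← h]
  have h1 := norm_inner_le_norm (𝕜 := ℂ) (A (V N fun j => (starRingEnd ℂ) (τ j))) (V N σ)
  have h2 := A.le_opNorm (V N fun j => (starRingEnd ℂ) (τ j))
  have h3 := V_norm N σ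
  have h4 := V_norm N fun j => (starRingEnd ℂ) (τ j)
  simp only [RCLike.norm_conj] at h4
  rw [← h3, ← h4]
  set X := ‖V N fun j => (starRingEnd ℂ) (τ j)‖
  set Y := ‖V N σ‖
  have h5 : X * Y ≤ (Y ^ 2 + X ^ 2) / 2 := by nlinarith [sq_nonneg (X - Y)]
  calc _ ≤ _ := h1
    _ ≤ ‖A‖ * X * Y := by gcongr
    _ = ‖A‖ * (X * Y) := by ring
    _ ≤ ‖A‖ * ((Y ^ 2 + X ^ 2) / 2) := by gcongr
    _ = _ := by ring

lemma op_of_BB' (A : l2 →L[ℂ] l2) (c : ℝ) (hc : 0 ≤ c) (M : ℕ)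
    (h : ∀ N, M ≤ N → ∀ (σ τ : ℕ → ℂ),
    ‖∑ i ∈ Finset.range N, ∑ j ∈ Finset.range N, ent A i j * σ i * τ j‖ ≤
      c * (∑ i ∈ Finset.range N, ‖σ i‖ ^ 2 + ∑ j ∈ Finset.range N, ‖τ j‖ ^ 2)) :
    ‖A‖ ≤ 2 * c := by
  have h1 : ∀ x y : l2, ‖⟪A x, y⟫_ℂ‖ ≤ c * (‖y‖ ^ 2 + ‖x‖ ^ 2) := by
    intro x y
    have ht : Filter.Tendsto (fun N => ‖⟪A (V N x), V N y⟫_ℂ‖) Filter.atTop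
        (nhds ‖⟪A x, y⟫_ℂ‖) :=
      (((A.continuous.tendsto x).comp (V_tendsto x)).inner (V_tendsto y)).norm
    refine le_of_tendsto ht (Filter.eventually_atTop.2 ⟨M, fun N hN => ?_⟩)
    rw [inner_V]
    refine (h N hN _ _).trans ?_
    simp only [RCLike.norm_conj]
    exact mul_le_mul_of_nonneg_left (add_le_add (V_norm_le N y) (V_norm_le N x)) hc
  refine A.opNorm_le_bound (by positivity) fun x => ?_
  by_cases hA : A x = 0
  · rw [hA, norm_zero]; positivity
  have hA' : 0 < ‖A x‖ := norm_pos_iff.2 hA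
  by_cases hx : x = 0
  · simp [hx] at hA
  have hx' : 0 < ‖x‖ := norm_pos_iff.2 hx
  have h2 := h1 x (((‖x‖ / ‖A x‖ : ℝ) : ℂ) • A x)
  rw [inner_smul_right, inner_self_eq_norm_sq_to_K, norm_smul, norm_mul, Complex.norm_real,
    Real.norm_of_nonneg (by positivity), div_mul_cancel₀ _ hA'.ne', norm_pow] at h2
  have h3 : ‖x‖ / ‖A x‖ * ‖A x‖ ^ 2 = ‖x‖ * ‖A x‖ := by field_simp
  simp only [RCLike.norm_ofReal, abs_norm] at h2
  rw [h3] at h2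
  have h4 : ‖x‖ * ‖A x‖ ≤ ‖x‖ * (2 * c * ‖x‖) := by nlinarith
  exact le_of_mul_le_mul_left h4 hx'

lemma op_of_BB (A : l2 →L[ℂ] l2) (c : ℝ) (hc : 0 ≤ c) (h : BB c (ent A)) : ‖A‖ ≤ 2 * c :=
  op_of_BB' A c hc 0 fun N _ => h N

lemma BB.add {c d : ℝ} {a b : ℕ → ℕ → ℂ} (ha : BB c a) (hb : BB d b) :
    BB (c + d) (fun i j => a i j + b i j) := by
  intro N σ τ
  simp only [add_mul, Finset.sum_add_distrib]
  exact (norm_add_le _ _).trans (add_le_add (by simpa using ha N σ τ) (by simpa using hb N σ τ))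

lemma BB.mult {c : ℝ} {m : ℕ → ℕ → ℂ} (hm : BB c m) (hc : 0 ≤ c) (a b : ℕ → ℕ → ℂ)
    (ha : ∀ i, Summable fun k => ‖a k i‖ ^ 2) (hb : ∀ j, Summable fun k => ‖b k j‖ ^ 2)
    (ε r : ℝ) (hr : 0 < r) (ha' : ∀ i, ∑' k, ‖a k i‖ ^ 2 ≤ ε / r ^ 2)
    (hb' : ∀ j, ∑' k, ‖b k j‖ ^ 2 ≤ ε * r ^ 2) :
    BB (c * ε) (fun i j => (∑' k, a k i * b k j) * m i j) := by
  intro N σ τ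
  have hs : ∀ i j, Summable fun k => a k i * b k j := by
    intro i j
    refine Summable.of_norm_bounded ((ha i).add (hb j)) fun k => ?_
    rw [norm_mul]
    nlinarith [sq_nonneg (‖a k i‖ - ‖b k j‖), sq_nonneg (‖a k i‖), sq_nonneg (‖b k j‖)]
  have hrC : (r : ℂ) ≠ 0 := by exact_mod_cast hr.ne'
  have e1 : HasSum (fun k => ∑ i ∈ Finset.range N, ∑ j ∈ Finset.range N,
      m i j * (r * a k i * σ i) * (b k j / r * τ j))
      (∑ i ∈ Finset.range N, ∑ j ∈ Finset.range N, (∑' k, a k i * b k j) * m i j * σ i * τ j) := by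
    refine hasSum_sum fun i _ => hasSum_sum fun j _ => ?_
    have := (hs i j).hasSum.mul_right (m i j * σ i * τ j)
    have h1 : (fun k => m i j * (r * a k i * σ i) * (b k j / r * τ j)) =
        fun k => a k i * b k j * (m i j * σ i * τ j) := by
      funext k
      field_simp
    rw [h1]
    simpa only [mul_assoc] using this
  have e2 : HasSum (fun k => c * (∑ i ∈ Finset.range N, ‖r * a k i * σ i‖ ^ 2 +
      ∑ j ∈ Finset.range N, ‖b k j / r * τ j‖ ^ 2))
      (c * (∑ i ∈ Finset.range N, (∑' k, ‖a k i‖ ^ 2) * (r ^ 2 * ‖σ i‖ ^ 2) +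
      ∑ j ∈ Finset.range N, (∑' k, ‖b k j‖ ^ 2) * (‖τ j‖ ^ 2 / r ^ 2))) := by
    refine HasSum.mul_left _ (HasSum.add (hasSum_sum fun i _ => ?_) (hasSum_sum fun i _ => ?_))
    · convert (ha i).hasSum.mul_right (r ^ 2 * ‖σ i‖ ^ 2) using 1
      ext k
      simp only [norm_mul, Complex.norm_real, Real.norm_eq_abs, mul_pow, sq_abs]; ring
    · convert (hb i).hasSum.mul_right (‖τ i‖ ^ 2 / r ^ 2) using 1
      ext k
      simp only [norm_mul, norm_div, Complex.norm_real, Real.norm_eq_abs, mul_pow, div_pow, sq_abs]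
      ring
  have h3 := tsum_of_norm_bounded e2 fun k => hm N (fun i => r * a k i * σ i) fun j => b k j / r * τ j
  rw [e1.tsum_eq] at h3
  refine h3.trans ?_
  rw [mul_assoc]
  refine mul_le_mul_of_nonneg_left ?_ hc
  rw [mul_add, Finset.mul_sum, Finset.mul_sum]
  refine add_le_add (Finset.sum_le_sum fun i _ => ?_) (Finset.sum_le_sum fun i _ => ?_)
  · refine (mul_le_mul_of_nonneg_right (ha' i) (by positivity)).trans (le_of_eq ?_)
    field_simp
  · refine (mul_le_mul_of_nonneg_right (hb' i) (by positivity)).trans (le_of_eq ?_)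
    field_simp

def EE (i j : ℕ) : l2 →L[ℂ] l2 := (innerSL ℂ (e j)).smulRight (e i)

lemma ent_EE (i j k l : ℕ) : ent (EE i j) k l = if k = i ∧ l = j then 1 else 0 := by
  simp only [ent, EE, ContinuousLinearMap.smulRight_apply, innerSL_apply_apply, inner_smul_left,
    inner_e_e]
  by_cases h1 : k = i <;> by_cases h2 : l = j <;> simp [h1, h2, eq_comm]
  all_goals (first | (intro h; exact absurd h.symm h1) | (intro h; exact absurd h.symm h2))

lemma ent_add (A B : l2 →L[ℂ] l2) (i j : ℕ) : ent (A + B) i j = ent A i j + ent B i j := by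
  simp [ent]

lemma ent_sub (A B : l2 →L[ℂ] l2) (i j : ℕ) : ent (A - B) i j = ent A i j - ent B i j := by
  simp [ent]

lemma ent_smul (c : ℂ) (A : l2 →L[ℂ] l2) (i j : ℕ) :
    ent (c • A) i j = (starRingEnd ℂ) c * ent A i j := by
  simp [ent, mul_comm]

lemma ent_sum {κ : Type} (F : Finset κ) (A : κ → l2 →L[ℂ] l2) (i j : ℕ) :
    ent (∑ k ∈ F, A k) i j = ∑ k ∈ F, ent (A k) i j := by
  simp [ent]

lemma ent_matrix (N : ℕ) (a : ℕ → ℕ → ℂ) (i j : ℕ) :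
    ent (∑ k ∈ Finset.range N, ∑ l ∈ Finset.range N, (starRingEnd ℂ) (a k l) • EE k l) i j =
      if i < N ∧ j < N then a i j else 0 := by
  simp only [ent_sum, ent_smul, ent_EE, Complex.conj_conj]
  by_cases hi : i < N <;> by_cases hj : j < N <;> simp [ite_and, hi, hj]

lemma ent_continuous (i j : ℕ) : Continuous fun A : l2 →L[ℂ] l2 => ent A i j := by
  unfold ent
  fun_prop

lemma eq_zero_of_ent {A : l2 →L[ℂ] l2} (h : ∀ i j, ent A i j = 0) : A = 0 := by
  have := op_of_BB A 0 le_rfl (by intro N σ τ; simp [h])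
  simpa using this

lemma eq_of_ent {A B : l2 →L[ℂ] l2} (h : ∀ i j, ent A i j = ent B i j) : A = B := by
  rw [← sub_eq_zero]
  exact eq_zero_of_ent fun i j => by rw [ent_sub, h, sub_self]

def TL (N : ℕ) : (l2 →L[ℂ] l2) →L[ℂ] (l2 →L[ℂ] l2) :=
  ∑ i ∈ Finset.range N, ∑ j ∈ Finset.range N,
    ((innerSL ℂ (e i)) ∘L (ContinuousLinearMap.apply ℂ l2 (e j))).smulRight (EE i j)

lemma ent_TL (N : ℕ) (B : l2 →L[ℂ] l2) (i j : ℕ) :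
    ent (TL N B) i j = if i < N ∧ j < N then ent B i j else 0 := by
  rw [← ent_matrix N (ent B)]
  congr 1
  simp only [TL, sum_apply]
  refine Finset.sum_congr rfl fun i _ => Finset.sum_congr rfl fun j _ => ?_
  simp [ent]

lemma TL_compact (N : ℕ) : IsCompactOperator (TL N) := by
  have : TL N ∈ compactOperator (RingHom.id ℂ) (l2 →L[ℂ] l2) (l2 →L[ℂ] l2) := by
    refine Submodule.sum_mem _ fun i _ => Submodule.sum_mem _ fun j _ => ?_
    change IsCompactOperator _
    have h : IsCompactOperator ((innerSL ℂ (e i)) ∘L (ContinuousLinearMap.apply ℂ l2 (e j))) :=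
      isCompactOperator_of_locallyCompactSpace_dom ((innerSL ℂ (e i)) ∘L (ContinuousLinearMap.apply ℂ l2 (e j)))
    exact h.clm_comp (ContinuousLinearMap.toSpanSingleton ℂ (EE i j))
  exact this

lemma TL_norm (N : ℕ) (B : l2 →L[ℂ] l2) : ‖TL N B‖ ≤ ‖B‖ := by
  have h := op_of_BB (TL N B) (‖B‖ / 2) (by positivity) (by
    intro M σ τ
    have h := BB_of_op B M (fun i => if i < N then σ i else 0) (fun i => if i < N then τ i else 0)
    refine le_trans (le_of_eq ?_) (h.trans (mul_le_mul_of_nonneg_left (add_le_add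
      (Finset.sum_le_sum fun i _ => ?_) (Finset.sum_le_sum fun i _ => ?_)) (by positivity)))
    · congr 1
      refine Finset.sum_congr rfl fun i _ => Finset.sum_congr rfl fun j _ => ?_
      rw [ent_TL]
      by_cases hi : i < N <;> by_cases hj : j < N <;> simp [hi, hj]
    · split_ifs <;> simp
    · split_ifs <;> simp)
  linarith

open Filter in
lemma tail_of_good (a : ℕ → ℕ → ℂ) (h0 : ∀ k, Tendsto (a k) atTop (nhds 0))
    (hu : TendstoUniformly (fun n i => ∑ k ∈ Finset.range n, ‖a k i‖ ^ 2)
          (fun i => ∑' k, ‖a k i‖ ^ 2) atTop) :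
    Tendsto (fun i => ∑' k, ‖a k i‖ ^ 2) atTop (nhds 0) := by
  rw [Metric.tendsto_atTop]
  intro ε hε
  obtain ⟨n, hn⟩ := (Metric.tendstoUniformly_iff.1 hu (ε / 2) (by positivity)).exists
  have h1 : Tendsto (fun i => ∑ k ∈ Finset.range n, ‖a k i‖ ^ 2) atTop (nhds 0) := by
    have : Tendsto (fun i => ∑ k ∈ Finset.range n, ‖a k i‖ ^ 2) atTop
        (nhds (∑ k ∈ Finset.range n, ‖(0 : ℂ)‖ ^ 2)) :=
      tendsto_finsetSum _ fun k _ => ((h0 k).norm.pow 2)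
    simpa using this
  obtain ⟨I, hI⟩ := Metric.tendsto_atTop.1 h1 (ε / 2) (by positivity)
  refine ⟨I, fun i hi => ?_⟩
  calc _ ≤ _ := dist_triangle _ (∑ k ∈ Finset.range n, ‖a k i‖ ^ 2) _
    _ < ε / 2 + ε / 2 := add_lt_add (hn i) (hI i hi)
    _ = ε := by ring

open Filter in
lemma good_of_tail (a : ℕ → ℕ → ℂ) (hs : ∀ i, Summable fun k => ‖a k i‖ ^ 2)
    (ht : Tendsto (fun i => ∑' k, ‖a k i‖ ^ 2) atTop (nhds 0)) :
    (∀ k, Tendsto (a k) atTop (nhds 0)) ∧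
    BddAbove (Set.range fun i => ∑' k, ‖a k i‖ ^ 2) ∧
    TendstoUniformly (fun n i => ∑ k ∈ Finset.range n, ‖a k i‖ ^ 2)
          (fun i => ∑' k, ‖a k i‖ ^ 2) atTop := by
  refine ⟨fun k => ?_, ht.bddAbove_range, ?_⟩
  · have h1 : Tendsto (fun i => ‖a k i‖ ^ 2) atTop (nhds 0) :=
      squeeze_zero (fun i => by positivity)
        (fun i => (hs i).le_tsum k fun _ _ => by positivity) ht
    have h2 := h1.sqrt
    simp only [Real.sqrt_sq (norm_nonneg _), Real.sqrt_zero] at h2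
    exact tendsto_zero_iff_norm_tendsto_zero.2 h2
  · rw [Metric.tendstoUniformly_iff]
    intro ε hε
    obtain ⟨I, hI⟩ := Metric.tendsto_atTop.1 ht ε hε
    have h1 : ∀ᶠ n in atTop, ∀ i ∈ Finset.range I,
        dist (∑' k, ‖a k i‖ ^ 2) (∑ k ∈ Finset.range n, ‖a k i‖ ^ 2) < ε := by
      rw [Finset.eventually_all]
      intro i _
      have := (hs i).hasSum.tendsto_sum_nat
      filter_upwards [Metric.tendsto_nhds.1 this ε hε] with n hn
      rwa [dist_comm]
    filter_upwards [h1] with n hn i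
    by_cases hi : i < I
    · exact hn i (Finset.mem_range.2 hi)
    · have h2 := hI i (not_lt.1 hi)
      have h3 := (hs i).sum_le_tsum (Finset.range n) fun _ _ => by positivity
      have h4 : 0 ≤ ∑ k ∈ Finset.range n, ‖a k i‖ ^ 2 := by positivity
      rw [Real.dist_eq, abs_lt] at *
      constructor <;> linarith [h2.1, h2.2]

section
variable (φ : ℕ × ℕ → ℂ) (S : (l2 →L[ℂ] l2) →L[ℂ] (l2 →L[ℂ] l2))
    (hS : ∀ A : l2 →L[ℂ] l2, ∀ i j, ent (S A) i j = φ (i, j) * ent A i j)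

open Filter in
lemma back (a b : ℕ → ℕ → ℂ)
    (hS : ∀ A : l2 →L[ℂ] l2, ∀ i j, ent (S A) i j = φ (i, j) * ent A i j)
    (ha : ∀ i, Summable fun k => ‖a k i‖ ^ 2) (hb : ∀ j, Summable fun k => ‖b k j‖ ^ 2)
    (hA : Tendsto (fun i => ∑' k, ‖a k i‖ ^ 2) atTop (nhds 0))
    (hB : Tendsto (fun i => ∑' k, ‖b k i‖ ^ 2) atTop (nhds 0))
    (hφ : ∀ i j, φ (i, j) = ∑' k, a k i * b k j) : IsCompactOperator S := by
  refine isCompactOperator_of_tendsto (l := atTop) (F := fun N => TL N ∘L S) ?_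
    (Eventually.of_forall fun N => (TL_compact N).comp_clm S)
  obtain ⟨α, hα⟩ := hA.bddAbove_range
  obtain ⟨β, hβ⟩ := hB.bddAbove_range
  set D := max (max α β) 1 with hD
  have hD0 : 0 < D := lt_of_lt_of_le one_pos (le_max_right _ _)
  have haD : ∀ i, ∑' k, ‖a k i‖ ^ 2 ≤ D := fun i =>
    (hα ⟨i, rfl⟩).trans ((le_max_left _ _).trans (le_max_left _ _))
  have hbD : ∀ i, ∑' k, ‖b k i‖ ^ 2 ≤ D := fun i =>
    (hβ ⟨i, rfl⟩).trans ((le_max_right _ _).trans (le_max_left _ _))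
  rw [Metric.tendsto_atTop]
  intro ε' hε'
  set ε := ε' / 4 with hεdef
  have hε : 0 < ε := by positivity
  obtain ⟨I, hI⟩ := Metric.tendsto_atTop.1 hA (ε ^ 2 / D) (by positivity)
  obtain ⟨J, hJ⟩ := Metric.tendsto_atTop.1 hB (ε ^ 2 / D) (by positivity)
  refine ⟨max I J, fun N hN => ?_⟩
  rw [dist_comm, dist_eq_norm]
  refine lt_of_le_of_lt (ContinuousLinearMap.opNorm_le_bound _ (M := 2 * ε) (by positivity)
    fun A => ?_) (by linarith)
  set r := Real.sqrt (D / ε) with hr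
  have hr0 : 0 < r := Real.sqrt_pos.2 (by positivity)
  have hr2 : r ^ 2 = D / ε := Real.sq_sqrt (by positivity)
  have tail : ∀ (c : ℕ → ℕ → ℂ) (d : ℝ), 0 ≤ d →
      (∀ i ≥ N, ∑' k, ‖c k i‖ ^ 2 ≤ d) →
      ∀ i, ∑' k, ‖if N ≤ i then c k i else 0‖ ^ 2 ≤ d := by
    intro c d hd h i
    by_cases hi : N ≤ i
    · simpa [hi] using h i hi
    · simpa [hi] using hd
  have tailS : ∀ (c : ℕ → ℕ → ℂ) (P : ℕ → Prop) [DecidablePred P],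
      (∀ i, Summable fun k => ‖c k i‖ ^ 2) →
      (∀ i, Summable fun k => ‖if P i then c k i else 0‖ ^ 2) := by
    intro c P _ h i
    by_cases hi : P i
    · simpa [hi] using h i
    · simp [hi, summable_zero]
  have e1 : ε ^ 2 / D = ε / r ^ 2 := by rw [hr2]; field_simp
  have e2 : D = ε * r ^ 2 := by rw [hr2]; field_simp
  have hAB := BB_of_op A
  have b1 := hAB.mult (by positivity) (fun k i => if N ≤ i then a k i else 0) b
    (tailS a (fun i => N ≤ i) ha) hb ε r hr0
    (fun i => e1 ▸ tail a (ε ^ 2 / D) (by positivity) (fun i hi => by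
      have := hI i ((le_max_left _ _).trans (hN.trans hi))
      rw [Real.dist_eq, abs_lt] at this
      linarith [this.2]) i) (fun i => e2 ▸ hbD i)
  have b2 := hAB.mult (by positivity) (fun k i => if i < N then a k i else 0)
    (fun k i => if N ≤ i then b k i else 0)
    (tailS a (fun i => i < N) ha) (tailS b (fun i => N ≤ i) hb) ε r⁻¹ (by positivity)
    (fun i => by
      have h1 : ε / r⁻¹ ^ 2 = D := by rw [e2]; field_simp
      rw [h1]
      by_cases hi : i < N
      · simpa [hi] using haD i
      · simpa [hi] using hD0.le)
    (fun i => by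
      have h1 : ε * r⁻¹ ^ 2 = ε ^ 2 / D := by rw [e1]; field_simp
      rw [h1]
      exact tail b (ε ^ 2 / D) (by positivity) (fun i hi => by
        have := hJ i ((le_max_right _ _).trans (hN.trans hi))
        rw [Real.dist_eq, abs_lt] at this
        linarith [this.2]) i)
  have hb3 := b1.add b2
  have heq : (fun i j => (∑' k, (if N ≤ i then a k i else 0) * b k j) * ent A i j +
      (∑' k, (if i < N then a k i else 0) * (if N ≤ j then b k j else 0)) * ent A i j) =
      ent ((S - TL N ∘L S) A) := by
    funext i j
    simp only [sub_apply, ContinuousLinearMap.comp_apply, ent_sub, ent_TL, hS,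
      hφ]
    by_cases hi : i < N
    · by_cases hj : j < N
      · simp [hi, hj, not_le.2 hi, not_le.2 hj]
      · simp [hi, hj, not_lt.1 hj, not_le.2 hi]
    · simp [hi, not_lt.1 hi]
  rw [heq] at hb3
  refine (op_of_BB _ _ (by positivity) hb3).trans (le_of_eq (by ring))

open Filter in
lemma unif (hS : ∀ A : l2 →L[ℂ] l2, ∀ i j, ent (S A) i j = φ (i, j) * ent A i j)
    (hc : IsCompactOperator S) (ε : ℝ) (hε : 0 < ε) :
    ∃ N, ∀ A, ‖S A - TL N (S A)‖ ≤ ε * ‖A‖ := by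
  by_contra hcon
  push Not at hcon
  choose A hA using hcon
  have hA0 : ∀ N, 0 < ‖A N‖ := by
    intro N
    rw [norm_pos_iff]
    intro h
    have := hA N
    simp [h] at this
  have hcomm : ∀ N B, S (TL N B) = TL N (S B) := by
    intro N B
    refine eq_of_ent fun i j => ?_
    rw [hS, ent_TL, ent_TL, hS]
    split_ifs <;> simp
  let D : ℕ → (l2 →L[ℂ] l2) := fun N => (((‖A N‖⁻¹ : ℝ) : ℂ)) • (A N - TL N (A N))
  have hD : ∀ N, D N ∈ Metric.closedBall (0 : l2 →L[ℂ] l2) 2 := by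
    intro N
    rw [mem_closedBall_zero_iff, norm_smul, Complex.norm_real, Real.norm_of_nonneg (by positivity),
      inv_mul_le_iff₀ (hA0 N)]
    have := norm_sub_le (A N) (TL N (A N))
    have := TL_norm N (A N)
    linarith
  have hSD : ∀ N, ε ≤ ‖S (D N)‖ := by
    intro N
    rw [map_smul, map_sub, hcomm, norm_smul, Complex.norm_real, Real.norm_of_nonneg (by positivity),
      le_inv_mul_iff₀ (hA0 N), mul_comm]
    exact (hA N).le
  obtain ⟨K, hK, hKs⟩ := IsCompactOperator.image_closedBall_subset_compact (f := S.toLinearMap) hc 2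
  obtain ⟨L, -, θ, hθ, hL⟩ := hK.tendsto_subseq (x := fun N => S (D N))
    fun N => hKs ⟨D N, hD N, rfl⟩
  have hL0 : L = 0 := by
    refine eq_zero_of_ent fun i j => ?_
    have h1 := ((ent_continuous i j).tendsto L).comp hL
    refine tendsto_nhds_unique h1 (tendsto_const_nhds.congr' ?_)
    filter_upwards [hθ.tendsto_atTop.eventually_gt_atTop (max i j)] with n hn
    have h2 : i < θ n ∧ j < θ n := ⟨(le_max_left _ _).trans_lt hn, (le_max_right _ _).trans_lt hn⟩
    simp only [Function.comp_apply, D, hS, ent_smul, ent_sub, ent_TL, h2, and_self, if_true,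
      sub_self, mul_zero]
  have h3 : ε ≤ ‖L‖ := ge_of_tendsto' hL.norm fun n => hSD _
  rw [hL0, norm_zero] at h3
  linarith

lemma factor (ψ : ℕ → ℕ → ℂ) (M : ℕ) (c : ℝ) (hc : 0 < c)
    (hsupp : ∀ i j, ¬ (i < M ∧ j < M) → ψ i j = 0)
    (h : ∀ A : l2 →L[ℂ] l2, ∃ B : l2 →L[ℂ] l2, ‖B‖ ≤ c * ‖A‖ ∧
      ∀ i j, ent B i j = ψ i j * ent A i j) :
    ∃ s t : ℕ → ℕ → ℂ, (∀ i, Summable fun k => ‖s k i‖ ^ 2) ∧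
      (∀ i, Summable fun k => ‖t k i‖ ^ 2) ∧
      (∀ i, ∑' k, ‖s k i‖ ^ 2 ≤ 3 * c) ∧ (∀ i, ∑' k, ‖t k i‖ ^ 2 ≤ 3 * c) ∧
      (∀ i, M ≤ i → ∀ k, s k i = 0) ∧ (∀ i, M ≤ i → ∀ k, t k i = 0) ∧
      ∀ i j, HasSum (fun k => s k i * t k j) (ψ i j) := by
  have hcC : (c : ℂ) ≠ 0 := by exact_mod_cast hc.ne'
  obtain ⟨m, s, t, h1, h2, h3⟩ := hb_finite (ι := Fin M) (fun i j => ψ i j / c) (by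
    intro a ha σ τ
    let a' : ℕ → ℕ → ℂ := fun i j => if h : i < M ∧ j < M then a ⟨i, h.1⟩ ⟨j, h.2⟩ else 0
    let ex : (Fin M → ℂ) → ℕ → ℂ := fun σ i => if h : i < M then σ ⟨i, h⟩ else 0
    let A : l2 →L[ℂ] l2 := ∑ k ∈ Finset.range M, ∑ l ∈ Finset.range M,
      (starRingEnd ℂ) (a' k l) • EE k l
    have hA : ∀ i j, ent A i j = a' i j := by
      intro i j
      rw [ent_matrix]
      by_cases hij : i < M ∧ j < M <;> simp [a', hij]
    have hA2 : ‖A‖ ≤ 2 * 1 := by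
      refine op_of_BB' A 1 zero_le_one M fun N hN σ τ => ?_
      have hsub : Finset.range M ⊆ Finset.range N := Finset.range_mono hN
      have e1 : ∑ i ∈ Finset.range N, ∑ j ∈ Finset.range N, ent A i j * σ i * τ j =
          ∑ i : Fin M, ∑ j : Fin M, a i j * σ i * τ j := by
        rw [← Finset.sum_subset hsub, Finset.sum_range]
        · refine Finset.sum_congr rfl fun i _ => ?_
          rw [← Finset.sum_subset hsub, Finset.sum_range]
          · refine Finset.sum_congr rfl fun j _ => ?_
            rw [hA]; simp [a']
          · intro j _ hj
            rw [hA]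
            have : ¬ j < M := by simpa using hj
            simp [a', this]
        · intro i _ hi
          refine Finset.sum_eq_zero fun j _ => ?_
          rw [hA]
          have : ¬ i < M := by simpa using hi
          simp [a', this]
      rw [e1, one_mul]
      refine (ha (fun i => σ i) (fun j => τ j)).trans (add_le_add ?_ ?_)
      · rw [← Finset.sum_range fun i => ‖σ i‖ ^ 2]
        exact Finset.sum_le_sum_of_subset_of_nonneg hsub fun _ _ _ => by positivity
      · rw [← Finset.sum_range fun i => ‖τ i‖ ^ 2]
        exact Finset.sum_le_sum_of_subset_of_nonneg hsub fun _ _ _ => by positivity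
    obtain ⟨B, hB, hBe⟩ := h A
    have h4 := BB_of_op B M (ex σ) (ex τ)
    simp only [Finset.sum_range, hBe, hA] at h4
    have e2 : ∑ i : Fin M, ∑ j : Fin M, ψ i j * a' i j * ex σ i * ex τ j =
        c * ∑ i : Fin M, ∑ j : Fin M, ψ i j / c * a i j * σ i * τ j := by
      simp only [Finset.mul_sum]
      refine Finset.sum_congr rfl fun i _ => Finset.sum_congr rfl fun j _ => ?_
      simp only [a', ex, i.2, j.2, and_self, dif_pos]
      field_simp
    have e3 : ∀ σ : Fin M → ℂ, ∑ i : Fin M, ‖ex σ i‖ ^ 2 = ∑ i : Fin M, ‖σ i‖ ^ 2 := by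
      intro σ
      refine Finset.sum_congr rfl fun i _ => ?_
      simp [ex]
    rw [e2, e3, e3, norm_mul, Complex.norm_real, Real.norm_of_nonneg hc.le] at h4
    have h5 : ‖B‖ / 2 ≤ c := by nlinarith
    have h6 := h4.trans (mul_le_mul_of_nonneg_right h5 (by positivity))
    exact le_of_mul_le_mul_left h6 hc)
  let ex : (ℕ → Fin M → ℂ) → ℕ → ℕ → ℂ := fun s k i =>
    if k < m then (if h : i < M then (Real.sqrt c : ℂ) * s k ⟨i, h⟩ else 0) else 0
  have g1 : ∀ s : ℕ → Fin M → ℂ, (∀ i, ∑ k ∈ Finset.range m, ‖s k i‖ ^ 2 ≤ 3) →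
      ∀ i, ∃ u, u ≤ 3 * c ∧ HasSum (fun k => ‖ex s k i‖ ^ 2) u := by
    intro s hs i
    refine ⟨_, ?_, hasSum_sum_of_ne_finset_zero (s := Finset.range m) fun k hk => ?_⟩
    · by_cases hi : i < M
      · have : ∑ k ∈ Finset.range m, ‖ex s k i‖ ^ 2 =
            c * ∑ k ∈ Finset.range m, ‖s k ⟨i, hi⟩‖ ^ 2 := by
          rw [Finset.mul_sum]
          refine Finset.sum_congr rfl fun k hk => ?_
          simp only [ex, Finset.mem_range.1 hk, hi, if_true, dif_pos, norm_mul, mul_pow,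
            Complex.norm_real, Real.norm_eq_abs, sq_abs, Real.sq_sqrt hc.le]
        rw [this, mul_comm 3]
        exact mul_le_mul_of_nonneg_left (hs _) hc.le
      · rw [Finset.sum_eq_zero fun k _ => by simp [ex, hi]]
        positivity
    · have : ¬ k < m := by simpa using hk
      simp [ex, this]
  have g2 : ∀ s : ℕ → Fin M → ℂ, ∀ i, M ≤ i → ∀ k, ex s k i = 0 := by
    intro s i hi k
    simp [ex, not_lt.2 hi]
  refine ⟨ex s, ex t, ?_, ?_, ?_, ?_, g2 s, g2 t, ?_⟩
  · intro i
    obtain ⟨u, hu, hus⟩ := g1 s h1 i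
    exact hus.summable
  · intro i
    obtain ⟨u, hu, hus⟩ := g1 t h2 i
    exact hus.summable
  · intro i
    obtain ⟨u, hu, hus⟩ := g1 s h1 i
    rwa [hus.tsum_eq]
  · intro i
    obtain ⟨u, hu, hus⟩ := g1 t h2 i
    rwa [hus.tsum_eq]
  · intro i j
    have e0 : HasSum (fun k => ex s k i * ex t k j)
        (∑ k ∈ Finset.range m, ex s k i * ex t k j) :=
      hasSum_sum_of_ne_finset_zero (s := Finset.range m) fun k hk => by
        have : ¬ k < m := by simpa using hk
        simp [ex, this]
    convert e0 using 1
    by_cases hij : i < M ∧ j < M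
    · have h4 := h3 ⟨i, hij.1⟩ ⟨j, hij.2⟩
      simp only at h4
      rw [div_eq_iff hcC] at h4
      rw [h4, Finset.sum_mul]
      refine Finset.sum_congr rfl fun k hk => ?_
      have hsq : (c : ℂ) = (Real.sqrt c : ℂ) * (Real.sqrt c : ℂ) := by
        rw [← Complex.ofReal_mul, Real.mul_self_sqrt hc.le]
      simp only [ex, Finset.mem_range.1 hk, hij.1, hij.2, if_true, dif_pos]
      rw [hsq]; ring
    · rw [hsupp i j hij, Finset.sum_eq_zero]
      intro k _
      by_cases hi : i < M
      · have hj : ¬ j < M := fun hj => hij ⟨hi, hj⟩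
        simp [ex, hj]
      · simp [ex, hi]

open Filter in
lemma glue (s : ℕ → ℕ → ℕ → ℂ) (C : ℝ) (Mk : ℕ → ℕ)
    (h1 : ∀ k i, Summable fun l => ‖s k l i‖ ^ 2)
    (h2 : ∀ k i, ∑' l, ‖s k l i‖ ^ 2 ≤ C * (1 / 2) ^ k)
    (h3 : ∀ k i, Mk k ≤ i → ∀ l, s k l i = 0) :
    (∀ i, Summable fun p : ℕ × ℕ => ‖s p.1 p.2 i‖ ^ 2) ∧
    Tendsto (fun i => ∑' p : ℕ × ℕ, ‖s p.1 p.2 i‖ ^ 2) atTop (nhds 0) := by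
  have hg : Summable fun k : ℕ => C * (1 / 2 : ℝ) ^ k :=
    (summable_geometric_of_lt_one (by norm_num) (by norm_num)).mul_left C
  have hsum : ∀ i, Summable fun p : ℕ × ℕ => ‖s p.1 p.2 i‖ ^ 2 := by
    intro i
    rw [summable_prod_of_nonneg fun p => by positivity]
    exact ⟨fun k => h1 k i, Summable.of_nonneg_of_le (fun k => tsum_nonneg fun l => by positivity)
      (fun k => h2 k i) hg⟩
  refine ⟨hsum, ?_⟩
  have e1 : ∀ i, ∑' p : ℕ × ℕ, ‖s p.1 p.2 i‖ ^ 2 = ∑' k, ∑' l, ‖s k l i‖ ^ 2 :=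
    fun i => (hsum i).tsum_prod
  simp only [e1]
  have : Tendsto (fun i => ∑' k, ∑' l, ‖s k l i‖ ^ 2) atTop (nhds (∑' _ : ℕ, (0 : ℝ))) := by
    refine tendsto_tsum_of_dominated_convergence hg (fun k => ?_) (Eventually.of_forall fun i k => ?_)
    · refine tendsto_const_nhds.congr' ?_
      filter_upwards [eventually_ge_atTop (Mk k)] with i hi
      simp [h3 k i hi]
    · rw [Real.norm_of_nonneg (tsum_nonneg fun l => by positivity)]
      exact h2 k i
  simpa using this

open Filter in
lemma forward (hS : ∀ A : l2 →L[ℂ] l2, ∀ i j, ent (S A) i j = φ (i, j) * ent A i j)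
    (hc : IsCompactOperator S) : ∃ a b : ℕ → ℕ → ℂ,
      (∀ i, Summable fun k => ‖a k i‖ ^ 2) ∧ (∀ j, Summable fun k => ‖b k j‖ ^ 2) ∧
      Tendsto (fun i => ∑' k, ‖a k i‖ ^ 2) atTop (nhds 0) ∧
      Tendsto (fun i => ∑' k, ‖b k i‖ ^ 2) atTop (nhds 0) ∧
      ∀ i j, φ (i, j) = ∑' k, a k i * b k j := by
  set C := ‖S‖ + 1 with hC
  have hC0 : 0 < C := by positivity
  have hN : ∀ k : ℕ, ∃ N, (k = 0 → N = 0) ∧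
      ∀ A, ‖S A - TL N (S A)‖ ≤ C * (1 / 2) ^ k * ‖A‖ := by
    intro k
    by_cases hk : k = 0
    · refine ⟨0, fun _ => rfl, fun A => ?_⟩
      have h0 : TL 0 (S A) = 0 := eq_zero_of_ent fun i j => by simp [ent_TL]
      rw [h0, sub_zero, hk, pow_zero, mul_one]
      exact (S.le_opNorm A).trans (mul_le_mul_of_nonneg_right (by linarith) (norm_nonneg _))
    · obtain ⟨N, hN⟩ := unif φ S hS hc (C * (1 / 2) ^ k) (by positivity)
      exact ⟨N, fun h => absurd h hk, hN⟩
  choose N hN0 hN using hN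
  let χ : ℕ → ℕ → ℕ → ℂ := fun k i j => if i < N k ∧ j < N k then φ (i, j) else 0
  have hfac := fun k => factor (fun i j => χ (k + 1) i j - χ k i j) (max (N k) (N (k + 1)))
    (2 * C * (1 / 2) ^ k) (by positivity) (by
      intro i j hij
      have h1 : ¬ (i < N k ∧ j < N k) := fun h => hij ⟨h.1.trans_le (le_max_left _ _),
        h.2.trans_le (le_max_left _ _)⟩
      have h2 : ¬ (i < N (k + 1) ∧ j < N (k + 1)) := fun h => hij ⟨h.1.trans_le (le_max_right _ _),
        h.2.trans_le (le_max_right _ _)⟩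
      simp only [χ, if_neg h1, if_neg h2, sub_zero]) (by
      intro A
      refine ⟨TL (N (k + 1)) (S A) - TL (N k) (S A), ?_, fun i j => ?_⟩
      · have h1 := hN k A
        have h2 := hN (k + 1) A
        have h3 : TL (N (k + 1)) (S A) - TL (N k) (S A) =
          (S A - TL (N k) (S A)) - (S A - TL (N (k + 1)) (S A)) := by abel
        rw [h3]
        refine (norm_sub_le _ _).trans ((add_le_add h1 h2).trans ?_)
        have h4 : 0 ≤ C * (1 / 2) ^ k * ‖A‖ := by positivity
        rw [pow_succ]
        nlinarith
      · rw [ent_sub, ent_TL, ent_TL, hS]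
        simp only [χ]
        split_ifs <;> ring)
  choose s t hs ht hs' ht' hs0 ht0 hst using hfac
  obtain ⟨gs1, gs2⟩ := glue s (3 * (2 * C)) (fun k => max (N k) (N (k + 1))) hs
    (fun k i => (hs' k i).trans (le_of_eq (by ring))) hs0
  obtain ⟨gt1, gt2⟩ := glue t (3 * (2 * C)) (fun k => max (N k) (N (k + 1))) ht
    (fun k i => (ht' k i).trans (le_of_eq (by ring))) ht0
  let E : ℕ ≃ ℕ × ℕ := Nat.pairEquiv.symm
  refine ⟨fun n i => s (E n).1 (E n).2 i, fun n i => t (E n).1 (E n).2 i, ?_, ?_, ?_, ?_, ?_⟩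
  · exact fun i => (E.summable_iff (f := fun p : ℕ × ℕ => ‖s p.1 p.2 i‖ ^ 2)).2 (gs1 i)
  · exact fun i => (E.summable_iff (f := fun p : ℕ × ℕ => ‖t p.1 p.2 i‖ ^ 2)).2 (gt1 i)
  · refine gs2.congr fun i => ?_
    exact (E.tsum_eq (fun p : ℕ × ℕ => ‖s p.1 p.2 i‖ ^ 2)).symm
  · refine gt2.congr fun i => ?_
    exact (E.tsum_eq (fun p : ℕ × ℕ => ‖t p.1 p.2 i‖ ^ 2)).symm
  · intro i j
    rw [E.tsum_eq (fun p : ℕ × ℕ => s p.1 p.2 i * t p.1 p.2 j)]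
    have hsm : Summable fun p : ℕ × ℕ => s p.1 p.2 i * t p.1 p.2 j := by
      refine Summable.of_norm_bounded ((gs1 i).add (gt1 j)) fun p => ?_
      rw [norm_mul]
      nlinarith [sq_nonneg (‖s p.1 p.2 i‖ - ‖t p.1 p.2 j‖), sq_nonneg (‖s p.1 p.2 i‖),
        sq_nonneg (‖t p.1 p.2 j‖)]
    have hh : HasSum (fun k => χ (k + 1) i j - χ k i j)
        (∑' p : ℕ × ℕ, s p.1 p.2 i * t p.1 p.2 j) :=
      hsm.hasSum.prod_fiberwise fun k => hst k i j
    have h1 := hh.tendsto_sum_nat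
    have h00 : χ 0 i j = 0 := by simp [χ, hN0 0 rfl]
    simp only [Finset.sum_range_sub (fun k => χ k i j), h00, sub_zero] at h1
    refine tendsto_nhds_unique ?_ h1
    rw [tendsto_iff_norm_sub_tendsto_zero]
    have hg : Tendsto (fun n : ℕ => C * (1 / 2 : ℝ) ^ n * ‖EE i j‖) atTop (nhds 0) := by
      have := ((tendsto_pow_atTop_nhds_zero_of_lt_one (r := (1 / 2 : ℝ)) (by norm_num)
        (by norm_num)).const_mul C).mul_const ‖EE i j‖
      simpa using this
    refine squeeze_zero (fun n => norm_nonneg _) (fun n => ?_) hg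
    refine le_trans ?_ (hN n (EE i j))
    have h2 : ent (S (EE i j) - TL (N n) (S (EE i j))) i j = φ (i, j) - χ n i j := by
      rw [ent_sub, ent_TL, hS, ent_EE]
      simp [χ]
    rw [norm_sub_rev, ← h2, ent]
    refine (norm_inner_le_norm _ _).trans ?_
    rw [e_orthonormal.1 i, mul_one]
    refine (ContinuousLinearMap.le_opNorm _ _).trans ?_
    rw [e_orthonormal.1 j, mul_one]

end

open Filter in
/-- Hladnik: A Schur multiplier `φ` induces a compact map
`S_φ : B(ℓ²) → B(ℓ²)` if and only if `φ(i,j) = Σ_k a_k(i) b_k(j)` for sequences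
`a_k, b_k ∈ c₀` with `sup_i Σ_k |a_k(i)|² < ∞`, `sup_j Σ_k |b_k(j)|² < ∞` and with the
series `Σ_k |a_k(·)|²` and `Σ_k |b_k(·)|²` uniformly convergent on `ℕ`. -/
theorem hladnik_compact_schur_multipliers (φ : ℕ × ℕ → ℂ)
    (S : (l2 →L[ℂ] l2) →L[ℂ] (l2 →L[ℂ] l2))
    (hS : ∀ A : l2 →L[ℂ] l2, ∀ i j, ent (S A) i j = φ (i, j) * ent A i j) :
    IsCompactOperator S
    ↔ ∃ a b : ℕ → ℕ → ℂ,
        (∀ k, Tendsto (a k) atTop (nhds 0)) ∧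
        (∀ k, Tendsto (b k) atTop (nhds 0)) ∧
        (∀ i, Summable fun k => ‖a k i‖ ^ 2) ∧
        (∀ j, Summable fun k => ‖b k j‖ ^ 2) ∧
        BddAbove (Set.range fun i => ∑' k, ‖a k i‖ ^ 2) ∧
        BddAbove (Set.range fun j => ∑' k, ‖b k j‖ ^ 2) ∧
        TendstoUniformly (fun n i => ∑ k ∈ Finset.range n, ‖a k i‖ ^ 2)
          (fun i => ∑' k, ‖a k i‖ ^ 2) atTop ∧
        TendstoUniformly (fun n j => ∑ k ∈ Finset.range n, ‖b k j‖ ^ 2)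
          (fun j => ∑' k, ‖b k j‖ ^ 2) atTop ∧
        ∀ i j, φ (i, j) = ∑' k, a k i * b k j := by
  constructor
  · intro hc
    obtain ⟨a, b, ha, hb, hA, hB, hφ⟩ := forward φ S hS hc
    obtain ⟨a1, a2, a3⟩ := good_of_tail a ha hA
    obtain ⟨b1, b2, b3⟩ := good_of_tail b hb hB
    exact ⟨a, b, a1, b1, ha, hb, a2, b2, a3, b3, hφ⟩
  · rintro ⟨a, b, a1, b1, ha, hb, a2, b2, a3, b3, hφ⟩
    exact back φ S a b hS ha hb (tail_of_good a a1 a3) (tail_of_good b b1 b3) hφ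


end
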